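/- arXiv:2309.15570 — 2 statements merged into one kernel-verified Lean document; each statement's English description precedes it below -/
import Mathlib

section
/- Let G be a finitely-generated ICC group, fix a finite generating set and write |t| for the corresponding word length of t ∈ G, fix c > 1, and define the weight ω(t) = c^{|t|}. Then the augmentation ideal ℓ¹₀(G, ω) = {f ∈ ℓ¹(G, ω) : Σ_{t∈G} f(t) = 0} is a weak*-closed two-sided ideal of the dual Banach algebra ℓ¹(G, ω) that intersects the centre trivially; in particular Z(ℓ¹(G, ω)) = ℂδ_e, but ℓ¹(G, ω) is not weak*-simple. -/
noncomputable section

open Filter Topology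
open scoped Classical ENNReal

/-- Convolution of two functions on a group. -/
def convFn {G : Type*} [Group G] (f g : G → ℂ) : G → ℂ := fun x => ∑' s : G, f s * g (s⁻¹ * x)

/-- The point mass `δ_t`. -/
def delta {G : Type*} (t : G) : G → ℂ := fun x => if x = t then 1 else 0

/-- `G` is an ICC group: every conjugacy class other than `{1}` is infinite. -/
def ICC (G : Type*) [Group G] : Prop := ∀ g : G, g ≠ 1 → {x : G | IsConj g x}.Infinite

/-- The word length of `g` with respect to the generating set `S` (allowing inverses of
generators as letters). -/
def wordLength {G : Type*} [Group G] (S : Finset G) (g : G) : ℕ :=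
  sInf {n : ℕ | ∃ l : List G, l.length = n ∧ (∀ x ∈ l, x ∈ S ∨ x⁻¹ ∈ S) ∧ l.prod = g}

/-- Membership in the weighted space `ℓ¹(G, ω)`. -/
def MemL1w {G : Type*} (ω : G → ℝ) (f : G → ℂ) : Prop := Summable fun t => ‖f t‖ * ω t

/-- `ℓ¹(G, ω)` as a type. -/
def L1w (G : Type*) (ω : G → ℝ) : Type _ := {f : G → ℂ // MemL1w ω f}

/-- The predicate of belonging to `c₀(G, 1/ω)`: `φ/ω` vanishes at infinity. -/
def MemC0w {G : Type*} (ω : G → ℝ) (φ : G → ℂ) : Prop :=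
  Tendsto (fun t => φ t / (ω t : ℂ)) cofinite (𝓝 0)

/-- The weak*-topology `σ(ℓ¹(G,ω), c₀(G,1/ω))` on `ℓ¹(G, ω)`. -/
instance L1w.topology (G : Type*) (ω : G → ℝ) : TopologicalSpace (L1w G ω) :=
  TopologicalSpace.induced
    (fun f : L1w G ω => fun φ : {φ : G → ℂ // MemC0w ω φ} => ∑' t : G, φ.1 t * f.1 t)
    inferInstance

/-- A set of elements of `ℓ¹(G, ω)` is weak*-closed. -/
def WStarClosedW {G : Type*} (ω : G → ℝ) (S : Set (G → ℂ)) : Prop :=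
  IsClosed {f : L1w G ω | f.1 ∈ S}

/-- A weak*-closed two-sided ideal of the dual Banach algebra `ℓ¹(G, ω)`. -/
def IsWStarClosedIdealW {G : Type*} [Group G] (ω : G → ℝ) (S : Set (G → ℂ)) : Prop :=
  S ⊆ {f | MemL1w ω f} ∧ (0 : G → ℂ) ∈ S ∧
  (∀ f ∈ S, ∀ g ∈ S, f + g ∈ S) ∧
  (∀ (c : ℂ), ∀ f ∈ S, c • f ∈ S) ∧
  (∀ f ∈ S, ∀ g : G → ℂ, MemL1w ω g → convFn g f ∈ S ∧ convFn f g ∈ S) ∧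
  WStarClosedW ω S

theorem exists_list_length_eq_wordLength {G : Type*} [Group G] {S : Finset G}
    (hS : Subgroup.closure (S : Set G) = ⊤) (g : G) :
    ∃ l : List G, l.length = wordLength S g ∧ (∀ x ∈ l, x ∈ S ∨ x⁻¹ ∈ S) ∧ l.prod = g := by
  have hg : g ∈ (Subgroup.closure (S : Set G)).toSubmonoid := hS ▸ Subgroup.mem_top g
  rw [Subgroup.closure_toSubmonoid] at hg
  obtain ⟨l, hl, hp⟩ := Submonoid.exists_list_of_mem_closure hg
  exact Nat.sInf_mem (s := {n : ℕ | ∃ l : List G, l.length = n ∧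
    (∀ x ∈ l, x ∈ S ∨ x⁻¹ ∈ S) ∧ l.prod = g}) ⟨l.length, l, rfl, hl, hp⟩

theorem wordLength_prod_le {G : Type*} [Group G] {S : Finset G} {l : List G}
    (hl : ∀ x ∈ l, x ∈ S ∨ x⁻¹ ∈ S) : wordLength S l.prod ≤ l.length :=
  Nat.sInf_le ⟨l, rfl, hl, rfl⟩

theorem wordLength_mul_le {G : Type*} [Group G] {S : Finset G}
    (hS : Subgroup.closure (S : Set G) = ⊤) (g h : G) :
    wordLength S (g * h) ≤ wordLength S g + wordLength S h := by
  obtain ⟨l, hl, hlS, rfl⟩ := exists_list_length_eq_wordLength hS g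
  obtain ⟨m, hm, hmS, rfl⟩ := exists_list_length_eq_wordLength hS h
  rw [← hl, ← hm, ← List.prod_append, ← List.length_append]
  refine wordLength_prod_le fun x hx => ?_
  rcases List.mem_append.1 hx with h | h
  exacts [hlS x h, hmS x h]

theorem finite_wordLength_le {G : Type*} [Group G] {S : Finset G}
    (hS : Subgroup.closure (S : Set G) = ⊤) (n : ℕ) : {g : G | wordLength S g ≤ n}.Finite := by
  have hT : {x : G | x ∈ S ∨ x⁻¹ ∈ S}.Finite :=
    S.finite_toSet.union (S.finite_toSet.preimage inv_injective.injOn)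
  have : Finite {x : G // x ∈ S ∨ x⁻¹ ∈ S} := hT
  refine ((List.finite_length_le {x : G // x ∈ S ∨ x⁻¹ ∈ S} n).image
    fun l => (l.map Subtype.val).prod).subset fun g hg => ?_
  obtain ⟨l, hl, hlS, hp⟩ := exists_list_length_eq_wordLength hS g
  lift l to List {x : G // x ∈ S ∨ x⁻¹ ∈ S} using hlS
  refine ⟨l, ?_, hp⟩
  rw [List.length_map] at hl
  exact hl.trans_le hg

theorem tendsto_wordLength_cofinite {G : Type*} [Group G] {S : Finset G}
    (hS : Subgroup.closure (S : Set G) = ⊤) : Tendsto (wordLength S) cofinite atTop := by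
  refine tendsto_atTop.2 fun n => ?_
  refine (finite_wordLength_le hS n).subset fun g hg => ?_
  have hlt : ¬ n ≤ wordLength S g := hg
  exact (not_le.1 hlt).le

theorem MemL1w.summable_norm {G : Type*} {ω : G → ℝ} (h1 : ∀ t, 1 ≤ ω t) {f : G → ℂ}
    (hf : MemL1w ω f) : Summable fun t => ‖f t‖ :=
  Summable.of_nonneg_of_le (fun _ => norm_nonneg _)
    (fun t => le_mul_of_one_le_right (norm_nonneg _) (h1 t)) hf

theorem MemL1w.summable {G : Type*} {ω : G → ℝ} (h1 : ∀ t, 1 ≤ ω t) {f : G → ℂ}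
    (hf : MemL1w ω f) : Summable f :=
  (hf.summable_norm h1).of_norm

theorem MemL1w.zero {G : Type*} (ω : G → ℝ) : MemL1w ω 0 := by
  simp [MemL1w, summable_zero]

theorem MemL1w.add {G : Type*} {ω : G → ℝ} (h1 : ∀ t, 1 ≤ ω t) {f g : G → ℂ}
    (hf : MemL1w ω f) (hg : MemL1w ω g) : MemL1w ω (f + g) := by
  have h0 (t : G) : 0 ≤ ω t := zero_le_one.trans (h1 t)
  refine Summable.of_nonneg_of_le (fun t => mul_nonneg (norm_nonneg _) (h0 t)) (fun t => ?_)
    (Summable.add hf hg)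
  rw [← add_mul]
  exact mul_le_mul_of_nonneg_right (norm_add_le _ _) (h0 t)

theorem MemL1w.smul {G : Type*} {ω : G → ℝ} (a : ℂ) {f : G → ℂ}
    (hf : MemL1w ω f) : MemL1w ω (a • f) := by
  simpa [MemL1w, mul_assoc] using Summable.mul_left ‖a‖ hf

theorem memL1w_delta {G : Type*} (ω : G → ℝ) (t : G) : MemL1w ω (delta t) := by
  refine summable_of_ne_finset_zero (s := {t}) fun x hx => ?_
  simp [delta, Finset.notMem_singleton.1 hx]

theorem tsum_delta {G : Type*} (t : G) : ∑' x, delta t x = 1 := by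
  simp [delta]

/-- The shear `(s, x) ↦ (s, s⁻¹ x)` of `G × G`. -/
def shearEquiv (G : Type*) [Group G] : G × G ≃ G × G where
  toFun p := (p.1, p.1⁻¹ * p.2)
  invFun p := (p.1, p.1 * p.2)
  left_inv p := by simp
  right_inv p := by simp

theorem summable_convFn_prod {G : Type*} [Group G] {f g : G → ℂ}
    (hf : Summable fun t => ‖f t‖) (hg : Summable fun t => ‖g t‖) :
    Summable fun p : G × G => f p.1 * g (p.1⁻¹ * p.2) :=
  (shearEquiv G).summable_iff.2 (summable_mul_of_summable_norm hf hg)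

theorem tsum_convFn {G : Type*} [Group G] {f g : G → ℂ}
    (hf : Summable fun t => ‖f t‖) (hg : Summable fun t => ‖g t‖) :
    ∑' x, convFn f g x = (∑' t, f t) * ∑' t, g t := by
  have hs := summable_convFn_prod hf hg
  calc ∑' x, convFn f g x = ∑' p : G × G, f p.1 * g (p.1⁻¹ * p.2) := by
        rw [hs.tsum_prod]
        exact Summable.tsum_comm (f := fun s x => f s * g (s⁻¹ * x)) hs
    _ = ∑' p : G × G, f p.1 * g p.2 :=
        (shearEquiv G).tsum_eq fun p : G × G => f p.1 * g p.2
    _ = _ := (tsum_mul_tsum_of_summable_norm hf hg).symm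

theorem MemL1w.convolution {G : Type*} [Group G] {ω : G → ℝ} (h1 : ∀ t, 1 ≤ ω t)
    (hmul : ∀ s t, ω (s * t) ≤ ω s * ω t) {f g : G → ℂ} (hf : MemL1w ω f) (hg : MemL1w ω g) :
    MemL1w ω (convFn f g) := by
  have h0 (t : G) : 0 ≤ ω t := zero_le_one.trans (h1 t)
  have hs : Summable fun p : G × G =>
      (‖f p.1‖ * ω p.1) * (‖g (p.1⁻¹ * p.2)‖ * ω (p.1⁻¹ * p.2)) :=
    (shearEquiv G).summable_iff.2 (Summable.mul_of_nonneg hf hg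
      (fun t => mul_nonneg (norm_nonneg _) (h0 t)) (fun t => mul_nonneg (norm_nonneg _) (h0 t)))
  have hle (s x : G) : ‖f s * g (s⁻¹ * x)‖ * ω x ≤
      (‖f s‖ * ω s) * (‖g (s⁻¹ * x)‖ * ω (s⁻¹ * x)) := by
    have h := hmul s (s⁻¹ * x)
    rw [mul_inv_cancel_left] at h
    calc ‖f s * g (s⁻¹ * x)‖ * ω x ≤ ‖f s * g (s⁻¹ * x)‖ * (ω s * ω (s⁻¹ * x)) :=
          mul_le_mul_of_nonneg_left h (norm_nonneg _)
      _ = _ := by rw [norm_mul]; ring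
  have hs' : Summable fun p : G × G => ‖f p.2 * g (p.2⁻¹ * p.1)‖ * ω p.1 :=
    Summable.of_nonneg_of_le (fun p => mul_nonneg (norm_nonneg _) (h0 _))
      (fun p => hle p.2 p.1) hs.prod_symm
  refine Summable.of_nonneg_of_le (fun t => mul_nonneg (norm_nonneg _) (h0 t)) (fun x => ?_)
    hs'.prod
  have hx : Summable fun s => ‖f s * g (s⁻¹ * x)‖ := by
    refine Summable.of_nonneg_of_le (fun _ => norm_nonneg _)
      (fun s => le_mul_of_one_le_right (norm_nonneg _) (h1 x)) (hs'.prod_factor x)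
  change _ ≤ ∑' s, ‖f s * g (s⁻¹ * x)‖ * ω x
  rw [tsum_mul_right]
  exact mul_le_mul_of_nonneg_right (norm_tsum_le_tsum_norm hx) (h0 x)

theorem convFn_delta_left {G : Type*} [Group G] (t : G) (f : G → ℂ) (x : G) :
    convFn (delta t) f x = f (t⁻¹ * x) := by
  unfold convFn
  rw [tsum_eq_single t fun s hs => by simp [delta, hs]]
  simp [delta]

theorem convFn_delta_right {G : Type*} [Group G] (t : G) (f : G → ℂ) (x : G) :
    convFn f (delta t) x = f (x * t⁻¹) := by
  unfold convFn
  rw [tsum_eq_single (x * t⁻¹) fun s hs => ?_]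
  · simp [delta]
  · have : s⁻¹ * x ≠ t := by
      rintro rfl
      simp at hs
    simp [delta, this]

theorem convFn_smul_left {G : Type*} [Group G] (a : ℂ) (f g : G → ℂ) :
    convFn (a • f) g = a • convFn f g := by
  ext x
  simp [convFn, mul_assoc, tsum_mul_left]

theorem convFn_smul_right {G : Type*} [Group G] (a : ℂ) (f g : G → ℂ) :
    convFn f (a • g) = a • convFn f g := by
  ext x
  simp [convFn, mul_left_comm, tsum_mul_left]

/-- In an ICC group, a summable function commuting with all point masses is supported at `1`. -/
theorem ICC.eq_smul_delta {G : Type*} [Group G] (hG : ICC G) {f : G → ℂ} (hf : Summable f)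
    (hcomm : ∀ t, convFn f (delta t) = convFn (delta t) f) : f = f 1 • delta 1 := by
  have hconj (g x : G) (h : IsConj g x) : f x = f g := by
    obtain ⟨t, rfl⟩ := isConj_iff.1 h
    simpa [convFn_delta_left, convFn_delta_right] using congrFun (hcomm t) (t * g)
  ext g
  by_cases hg : g = 1
  · simp [hg, delta]
  · suffices f g = 0 by simp [delta, hg, this]
    by_contra hne
    have hev : ∀ᶠ x in cofinite, f x ≠ f g := hf.tendsto_cofinite_zero.eventually_ne (Ne.symm hne)
    refine hG g hg (Set.Finite.subset hev fun x hx => ?_)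
    simpa using hconj g x hx

theorem isClosed_setOf_tsum_eq_zero {G : Type*} {ω : G → ℝ} (hω : Tendsto ω cofinite atTop) :
    IsClosed {f : L1w G ω | ∑' t, f.1 t = 0} := by
  have h1 : MemC0w ω (fun _ => 1) := by
    refine tendsto_zero_iff_norm_tendsto_zero.2 ?_
    simpa [Function.comp_def, Pi.inv_def] using
      (tendsto_abs_atTop_atTop.comp hω).inv_tendsto_atTop
  have hc : Continuous fun f : L1w G ω => ∑' t : G, (1 : ℂ) * f.1 t :=
    continuous_pi_iff.1 (continuous_induced_dom (f := fun (f : L1w G ω)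
      (φ : {φ : G → ℂ // MemC0w ω φ}) => ∑' t : G, φ.1 t * f.1 t)) ⟨fun _ => 1, h1⟩
  simpa [Set.preimage, Set.mem_singleton_iff] using isClosed_singleton.preimage hc (t := {(0 : ℂ)})

theorem isWStarClosedIdealW_augmentation {G : Type*} [Group G] {ω : G → ℝ}
    (h1 : ∀ t, 1 ≤ ω t) (hmul : ∀ s t, ω (s * t) ≤ ω s * ω t) (hω : Tendsto ω cofinite atTop) :
    IsWStarClosedIdealW ω {f : G → ℂ | MemL1w ω f ∧ ∑' t : G, f t = 0} := by
  refine ⟨fun f hf => hf.1, ⟨MemL1w.zero ω, by simp⟩, ?_, ?_, ?_, ?_⟩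
  · rintro f ⟨hf, hf0⟩ g ⟨hg, hg0⟩
    refine ⟨hf.add h1 hg, ?_⟩
    simp [(hf.summable h1).tsum_add (hg.summable h1), hf0, hg0]
  · rintro a f ⟨hf, hf0⟩
    exact ⟨hf.smul a, by simp [tsum_mul_left, hf0]⟩
  · rintro f ⟨hf, hf0⟩ g hg
    refine ⟨⟨hg.convolution h1 hmul hf, ?_⟩, ⟨hf.convolution h1 hmul hg, ?_⟩⟩ <;>
      simp [tsum_convFn, hf.summable_norm h1, hg.summable_norm h1, hf0]
  · have h : {f : L1w G ω | f.1 ∈ {f : G → ℂ | MemL1w ω f ∧ ∑' t : G, f t = 0}} =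
        {f : L1w G ω | ∑' t, f.1 t = 0} := Set.ext fun f => and_iff_right f.2
    rw [WStarClosedW, h]
    exact isClosed_setOf_tsum_eq_zero hω

/-- **Proposition 2.4.** Let `G` be a finitely-generated ICC group, `|·|` the word length
with respect to a finite generating set, `c > 1`, and `ω(t) = c^{|t|}`. Then the
augmentation ideal `ℓ¹₀(G, ω) = {f : Σ_t f(t) = 0}` is a weak*-closed two-sided ideal of
`ℓ¹(G, ω)` intersecting the centre trivially; in particular `Z(ℓ¹(G, ω)) = ℂ δ_e`, but
`ℓ¹(G, ω)` is not weak*-simple. -/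
theorem augmentation_ideal_weighted (G : Type*) [Group G] [Infinite G] (hICC : ICC G)
    (S : Finset G) (hS : Subgroup.closure (S : Set G) = ⊤)
    (c : ℝ) (hc : 1 < c)
    (ω : G → ℝ) (hω : ω = fun t => c ^ wordLength S t) :
    IsWStarClosedIdealW ω {f : G → ℂ | MemL1w ω f ∧ ∑' t : G, f t = 0} ∧
    (∀ f ∈ {f : G → ℂ | MemL1w ω f ∧ ∑' t : G, f t = 0},
      (∀ g : G → ℂ, MemL1w ω g → convFn f g = convFn g f) → f = 0) ∧
    {f : G → ℂ | MemL1w ω f ∧ ∀ g : G → ℂ, MemL1w ω g → convFn f g = convFn g f} =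
      {f : G → ℂ | ∃ a : ℂ, f = a • delta (1 : G)} ∧
    ¬ (∀ I : Set (G → ℂ), IsWStarClosedIdealW ω I → I = {0} ∨ I = {f | MemL1w ω f}) := by
  have h1 (t : G) : 1 ≤ ω t := hω ▸ one_le_pow₀ hc.le
  have hmul (s t : G) : ω (s * t) ≤ ω s * ω t := by
    simp only [hω, ← pow_add]
    exact pow_le_pow_right₀ hc.le (wordLength_mul_le hS s t)
  have htop : Tendsto ω cofinite atTop :=
    hω ▸ (tendsto_pow_atTop_atTop_of_one_lt hc).comp (tendsto_wordLength_cofinite hS)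
  have hideal := isWStarClosedIdealW_augmentation h1 hmul htop
  have hcentre (f : G → ℂ) (hf : MemL1w ω f)
      (hcomm : ∀ g, MemL1w ω g → convFn f g = convFn g f) : f = f 1 • delta 1 :=
    hICC.eq_smul_delta (hf.summable h1) fun t => hcomm _ (memL1w_delta ω t)
  refine ⟨hideal, ?_, ?_, ?_⟩
  · rintro f ⟨hf, hf0⟩ hcomm
    have h := hcentre f hf hcomm
    have h0 : f 1 = 0 := by
      rw [h] at hf0
      simpa [tsum_mul_left, tsum_delta] using hf0
    rw [h, h0, zero_smul]
  · ext f
    refine ⟨fun ⟨hf, hcomm⟩ => ⟨f 1, hcentre f hf hcomm⟩, ?_⟩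
    rintro ⟨a, rfl⟩
    refine ⟨(memL1w_delta ω 1).smul a, fun g _ => ?_⟩
    rw [convFn_smul_left, convFn_smul_right]
    congr 1
    ext x
    simp [convFn_delta_left, convFn_delta_right]
  · intro h
    rcases h _ hideal with h | h
    · obtain ⟨g, hg⟩ := exists_ne (1 : G)
      have hmem : delta g + (-1 : ℂ) • delta 1 ∈
          {f : G → ℂ | MemL1w ω f ∧ ∑' t : G, f t = 0} := by
        have hd := (memL1w_delta ω (1 : G)).smul (-1)
        refine ⟨(memL1w_delta ω g).add h1 hd, ?_⟩
        simp only [Pi.add_apply]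
        rw [((memL1w_delta ω g).summable h1).tsum_add (hd.summable h1)]
        simp [tsum_neg, tsum_delta]
      rw [h] at hmem
      simpa [delta, hg] using congrFun hmem g
    · have hmem : delta (1 : G) ∈ {f : G → ℂ | MemL1w ω f} := memL1w_delta ω 1
      rw [← h] at hmem
      exact one_ne_zero ((tsum_delta (1 : G)).symm.trans hmem.2)
end
end

section
/- Let G be a discrete group, let N be a normal subgroup of G, and let T be a transversal (a set of coset representatives) for N in G. Let J be a weak*-closed two-sided ideal of ℓ¹(N) with {0} ≠ J ≠ ℓ¹(N), satisfying δ_s * J * δ_{s⁻¹} = J for all s ∈ G. Then I := ⊕_{t∈T} δ_t * J = {f ∈ ℓ¹(G) : the restriction of δ_{t⁻¹} * f to N belongs to J for every t ∈ T} is a weak*-closed two-sided ideal of ℓ¹(G) with {0} ≠ I ≠ ℓ¹(G). -/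
noncomputable section

open Filter Topology
open scoped Classical ENNReal

/-- Membership in `ℓ¹(G)`: absolutely summable complex-valued functions on `G`. -/
def MemL1 {G : Type*} (f : G → ℂ) : Prop := Summable fun t => ‖f t‖

/-- `ℓ¹(G)` as a type. -/
def L1 (G : Type*) : Type _ := {f : G → ℂ // MemL1 f}

/-- The predicate of belonging to `c₀(G)`: functions vanishing at infinity on the
discrete group `G`. -/
def MemC0 {G : Type*} (φ : G → ℂ) : Prop := Tendsto φ cofinite (𝓝 0)

/-- The weak*-topology `σ(ℓ¹(G), c₀(G))` on `ℓ¹(G)`, induced by the pairings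
`f ↦ Σ_{t∈G} φ(t) f(t)` with `φ ∈ c₀(G)`. -/
instance L1.topology (G : Type*) : TopologicalSpace (L1 G) :=
  TopologicalSpace.induced
    (fun f : L1 G => fun φ : {φ : G → ℂ // MemC0 φ} => ∑' t : G, φ.1 t * f.1 t)
    inferInstance

/-- A set of elements of `ℓ¹(G)` is weak*-closed. -/
def WStarClosed {G : Type*} (S : Set (G → ℂ)) : Prop := IsClosed {f : L1 G | f.1 ∈ S}

/-- A weak*-closed two-sided ideal of the convolution algebra `ℓ¹(G)`. -/
def IsWStarClosedIdeal {G : Type*} [Group G] (S : Set (G → ℂ)) : Prop :=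
  S ⊆ {f | MemL1 f} ∧ (0 : G → ℂ) ∈ S ∧
  (∀ f ∈ S, ∀ g ∈ S, f + g ∈ S) ∧
  (∀ (c : ℂ), ∀ f ∈ S, c • f ∈ S) ∧
  (∀ f ∈ S, ∀ g : G → ℂ, MemL1 g → convFn g f ∈ S ∧ convFn f g ∈ S) ∧
  WStarClosed S

/-- `f` is supported in the subset `N` of `G`. -/
def SuppIn {G : Type*} (N : Set G) (f : G → ℂ) : Prop := ∀ x, x ∉ N → f x = 0

/-- `ℓ¹(N)`, identified with the subalgebra of `ℓ¹(G)` of functions supported on `N`. -/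
def L1On {G : Type*} (N : Set G) : Set (G → ℂ) := {f | MemL1 f ∧ SuppIn N f}

/-- A two-sided ideal of `ℓ¹(N)` (identified with the functions in `ℓ¹(G)` supported
on `N`). -/
def IsIdealOn {G : Type*} [Group G] (N : Set G) (J : Set (G → ℂ)) : Prop :=
  J ⊆ L1On N ∧ (0 : G → ℂ) ∈ J ∧
  (∀ f ∈ J, ∀ g ∈ J, f + g ∈ J) ∧
  (∀ (c : ℂ), ∀ f ∈ J, c • f ∈ J) ∧
  (∀ f ∈ J, ∀ g ∈ L1On N, convFn g f ∈ J ∧ convFn f g ∈ J)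

/-- The conjugate `f^s = δ_s * f * δ_{s⁻¹}` of `f ∈ ℓ¹(G)` by `s ∈ G`,
so that `f^s (g) = f (s⁻¹ g s)`. -/
def conjFn {G : Type*} [Group G] (s : G) (f : G → ℂ) : G → ℂ := fun g => f (s⁻¹ * g * s)

/-- `J` is invariant under conjugation by elements of `G`:
`δ_s * J * δ_{s⁻¹} = J` for all `s ∈ G`. -/
def GConjInvariant {G : Type*} [Group G] (J : Set (G → ℂ)) : Prop :=
  ∀ s : G, conjFn s '' J = J

/-- `T` is a transversal (set of coset representatives) for `N` in `G`. -/
def IsTransversal {G : Type*} [Group G] (N : Set G) (T : Set G) : Prop :=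
  ∀ g : G, ∃! t : G, t ∈ T ∧ t⁻¹ * g ∈ N

/-- The set `⊕_{t ∈ T} δ_t * J`: those `f ∈ ℓ¹(G)` such that for every `t ∈ T` the
restriction of `δ_{t⁻¹} * f` to `N` belongs to `J`. -/
def bigOplus {G : Type*} [Group G] (N T : Set G) (J : Set (G → ℂ)) : Set (G → ℂ) :=
  {f | MemL1 f ∧ ∀ t ∈ T, N.indicator (convFn (delta t⁻¹) f) ∈ J}

/-- The FC-centre of `G`: the set of elements with finite conjugacy class. -/
def FCset (G : Type*) [Group G] : Set G := {t : G | {x : G | IsConj t x}.Finite}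

theorem MemC0.exists_norm_le {G : Type*} {φ : G → ℂ} (hφ : MemC0 φ) : ∃ C, ∀ t, ‖φ t‖ ≤ C := by
  obtain ⟨C, hC⟩ := (hφ.norm.isBoundedUnder_le).bddAbove_range_of_cofinite
  exact ⟨C, fun t => hC ⟨t, rfl⟩⟩

theorem MemL1.comp_injective {G H : Type*} {f : G → ℂ} (hf : MemL1 f) {e : H → G}
    (he : Function.Injective e) : MemL1 fun x => f (e x) :=
  Summable.comp_injective (f := fun t => ‖f t‖) hf he

theorem MemL1.indicator {G : Type*} {f : G → ℂ} (hf : MemL1 f) (N : Set G) :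
    MemL1 (N.indicator f) :=
  Summable.of_nonneg_of_le (fun _ => norm_nonneg _) (fun _ => norm_indicator_le_norm_self _ _) hf

theorem MemL1.tsum {G ι : Type*} {F : ι → G → ℂ} (hF : Summable fun p : ι × G => ‖F p.1 p.2‖) :
    MemL1 fun x => ∑' i, F i x := by
  have h := hF.prod_symm
  exact Summable.of_nonneg_of_le (fun _ => norm_nonneg _)
    (fun x => norm_tsum_le_tsum_norm (h.prod_factor x)) h.prod

/-- The element of `L1 G` given by an absolutely summable function. -/
def L1.mk {G : Type*} (f : G → ℂ) (hf : MemL1 f) : L1 G := ⟨f, hf⟩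

/-- The pairings with elements of `c₀(G)`. -/
def L1.pairing {G : Type*} (f : L1 G) (φ : {φ : G → ℂ // MemC0 φ}) : ℂ := ∑' t : G, φ.1 t * f.1 t

theorem L1.isInducing_pairing (G : Type*) : Topology.IsInducing (L1.pairing (G := G)) := ⟨rfl⟩

theorem memL1_delta {G : Type*} (t : G) : MemL1 (delta t) :=
  summable_of_ne_finset_zero (s := {t}) fun x hx => by
    simp [delta, Finset.mem_singleton.not.1 hx]

theorem delta_mem_L1On {G : Type*} {N : Set G} {n : G} (hn : n ∈ N) :
    delta n ∈ L1On N :=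
  ⟨memL1_delta n, fun x hx => if_neg fun h : x = n => hx (h ▸ hn)⟩

/-- An `ℓ¹`-convergent sum of elements of a weak*-closed additive set belongs to that set. -/
theorem WStarClosed.tsum_mem {G ι : Type*} {S : Set (G → ℂ)} (hS : WStarClosed S)
    (h0 : (0 : G → ℂ) ∈ S) (hadd : ∀ f ∈ S, ∀ g ∈ S, f + g ∈ S) {F : ι → G → ℂ}
    (hFS : ∀ i, F i ∈ S) (hF : Summable fun p : ι × G => ‖F p.1 p.2‖) :
    (fun x => ∑' i, F i x) ∈ S := by
  have hL1 (i : ι) : MemL1 (F i) := hF.prod_factor i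
  have hsum_L1 (s : Finset ι) : MemL1 (∑ i ∈ s, F i) :=
    Summable.of_nonneg_of_le (fun _ => norm_nonneg _)
      (fun x => by rw [Finset.sum_apply]; exact norm_sum_le _ _)
      (summable_sum fun i _ => hL1 i)
  have hsum_mem (s : Finset ι) : ∑ i ∈ s, F i ∈ S :=
    Finset.sum_induction F (· ∈ S) (fun f g hf hg => hadd f hf g hg) h0 fun i _ => hFS i
  have hlim : Tendsto (fun s : Finset ι => L1.mk (∑ i ∈ s, F i) (hsum_L1 s)) atTop
      (𝓝 (L1.mk (fun x => ∑' i, F i x) (MemL1.tsum hF))) := by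
    refine (L1.isInducing_pairing G).tendsto_nhds_iff.2 (tendsto_pi_nhds.2 fun φ => ?_)
    obtain ⟨C, hC⟩ := φ.2.exists_norm_le
    have hK : Summable fun p : ι × G => φ.1 p.2 * F p.1 p.2 :=
      Summable.of_norm_bounded (hF.mul_left C) fun p => by
        rw [norm_mul]
        exact mul_le_mul_of_nonneg_right (hC _) (norm_nonneg _)
    have hsum := hK.prod.hasSum
    rw [← Summable.tsum_comm (f := fun i t => φ.1 t * F i t) hK] at hsum
    simp only [tsum_mul_left] at hsum
    refine Tendsto.congr (fun s => ?_) hsum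
    change _ = ∑' t, φ.1 t * (∑ i ∈ s, F i) t
    simp only [Finset.sum_apply, Finset.mul_sum]
    exact (Summable.tsum_finsetSum fun i _ => hK.prod_factor i).symm
  exact IsClosed.mem_of_tendsto (s := {f : L1 G | f.1 ∈ S}) hS hlim (Eventually.of_forall hsum_mem)

section Convolution

variable {G : Type*} [Group G]

theorem MemL1.summable_convFn {f g : G → ℂ} (hf : MemL1 f) (hg : MemL1 g) :
    Summable fun p : G × G => ‖f p.1 * g (p.1⁻¹ * p.2)‖ :=
  (Summable.mul_norm hf hg).comp_injective
    (i := fun p : G × G => (p.1, p.1⁻¹ * p.2)) fun p q h => by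
      obtain ⟨h₁, h₂⟩ := Prod.ext_iff.1 h
      simp only at h₁ h₂
      rw [h₁] at h₂
      exact Prod.ext h₁ (mul_left_cancel h₂)

theorem MemL1.convFn {f g : G → ℂ} (hf : MemL1 f) (hg : MemL1 g) : MemL1 (convFn f g) :=
  MemL1.tsum (hf.summable_convFn hg)

theorem convFn_delta_apply (t : G) (f : G → ℂ) (x : G) : convFn (delta t) f x = f (t⁻¹ * x) := by
  rw [convFn, tsum_eq_single t fun s hs => by simp [delta, hs]]
  simp [delta]

theorem convFn_apply_right (f g : G → ℂ) (x : G) :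
    convFn f g x = ∑' u, g u * f (x * u⁻¹) := by
  rw [convFn, ← ((Equiv.inv G).trans (Equiv.mulLeft x)).tsum_eq]
  simp [mul_comm]

/-- The translate `δ_{s⁻¹} * f` restricted to `N`. -/
def coset (N : Set G) (s : G) (f : G → ℂ) : G → ℂ := N.indicator fun x => f (s * x)

theorem indicator_convFn_delta_inv (N : Set G) (s : G) (f : G → ℂ) :
    N.indicator (convFn (delta s⁻¹) f) = coset N s f := by
  rw [coset]
  congr 1
  ext x
  rw [convFn_delta_apply, inv_inv]

theorem coset_add (N : Set G) (s : G) (f g : G → ℂ) :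
    coset N s (f + g) = coset N s f + coset N s g :=
  Set.indicator_add ..

theorem coset_smul (N : Set G) (s : G) (c : ℂ) (f : G → ℂ) :
    coset N s (c • f) = c • coset N s f :=
  Set.indicator_const_smul (N : Set G) c _

theorem MemL1.coset {f : G → ℂ} (hf : MemL1 f) (N : Set G) (s : G) : MemL1 (coset N s f) :=
  (hf.comp_injective (mul_right_injective s)).indicator N

theorem coset_mul (N : Subgroup G) (t : G) {n : G} (hn : n ∈ N) (f : G → ℂ) :
    coset (N : Set G) (t * n) f = convFn (delta n⁻¹) (coset (N : Set G) t f) := by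
  ext x
  rw [convFn_delta_apply, inv_inv]
  simp [coset, Set.indicator_apply, N.mul_mem_cancel_left hn, mul_assoc]

theorem coset_one_of_suppIn {N : Set G} {f : G → ℂ} (hf : SuppIn N f) : coset N 1 f = f := by
  ext x
  by_cases hx : x ∈ N
  · simp [coset, hx]
  · simp [coset, hx, hf x hx]

theorem mem_bigOplus_iff {N : Subgroup G} {T : Set G} (hT : IsTransversal (N : Set G) T)
    {J : Set (G → ℂ)} (hJ : IsIdealOn (N : Set G) J) {f : G → ℂ} :
    f ∈ bigOplus (N : Set G) T J ↔ MemL1 f ∧ ∀ s, coset (N : Set G) s f ∈ J := by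
  refine ⟨fun h => ⟨h.1, fun s => ?_⟩, fun h => ⟨h.1, fun t _ => ?_⟩⟩
  · obtain ⟨t, ⟨htT, htN⟩, -⟩ := hT s
    have := h.2 t htT
    rw [indicator_convFn_delta_inv] at this
    rw [← mul_inv_cancel_left t s, coset_mul N t htN]
    exact (hJ.2.2.2.2 _ this _ (delta_mem_L1On (N.inv_mem htN))).1
  · rw [indicator_convFn_delta_inv]
    exact h.2 t

theorem continuous_coset (N : Set G) (s : G) :
    Continuous fun f : L1 G => L1.mk (coset N s f.1) (f.2.coset N s) := by
  refine (L1.isInducing_pairing G).continuous_iff.2 (continuous_pi fun φ => ?_)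
  let ψ : {φ : G → ℂ // MemC0 φ} := ⟨fun y => N.indicator φ.1 (s⁻¹ * y), by
    have h : MemC0 (N.indicator φ.1) :=
      squeeze_zero_norm (fun _ => norm_indicator_le_norm_self _ _) (by simpa using φ.2.norm)
    exact h.comp (mul_right_injective s⁻¹).tendsto_cofinite⟩
  refine ((continuous_apply ψ).comp (L1.isInducing_pairing G).continuous).congr fun f => ?_
  simp only [Function.comp_apply, L1.pairing, L1.mk, ψ]
  rw [← (Equiv.mulLeft s).tsum_eq]
  refine tsum_congr fun x => ?_
  by_cases hx : x ∈ N <;> simp [coset, hx]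

variable {N : Subgroup G} {J : Set (G → ℂ)}

theorem coset_convFn_mem (hJ : IsIdealOn (N : Set G) J) (hJc : WStarClosed J) {f g : G → ℂ}
    (hf : MemL1 f) (hg : MemL1 g) (hfJ : ∀ s, coset (N : Set G) s f ∈ J) (s : G) :
    coset (N : Set G) s (convFn g f) ∈ J := by
  have key : coset (N : Set G) s (convFn g f) =
      fun x => ∑' r, (g r • coset (N : Set G) (r⁻¹ * s) f) x := by
    ext x
    by_cases hx : x ∈ N <;> simp [coset, hx, convFn, mul_assoc]
  rw [key]
  refine hJc.tsum_mem hJ.2.1 hJ.2.2.1 (fun r => hJ.2.2.2.1 _ _ (hfJ _)) ?_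
  refine Summable.of_nonneg_of_le (fun _ => norm_nonneg _) (fun p => ?_)
    ((hg.summable_convFn hf).comp_injective (i := fun p : G × G => (p.1, s * p.2))
      fun p q h => by simpa [Prod.ext_iff] using h)
  by_cases hx : p.2 ∈ N <;> simp [coset, hx, mul_assoc, mul_nonneg]

theorem coset_convFn_mem_right [N.Normal] (hJ : IsIdealOn (N : Set G) J) (hJc : WStarClosed J)
    (hJinv : GConjInvariant J) {f g : G → ℂ} (hf : MemL1 f) (hg : MemL1 g)
    (hfJ : ∀ s, coset (N : Set G) s f ∈ J) (s : G) :
    coset (N : Set G) s (convFn f g) ∈ J := by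
  have conj (u x : G) : conjFn u⁻¹ (coset (N : Set G) (s * u⁻¹) f) x =
      (N : Set G).indicator (fun x => f (s * x * u⁻¹)) x := by
    have hmem : u * x * u⁻¹ ∈ N ↔ x ∈ N := (Subgroup.Normal.mem_comm_iff inferInstance).trans
      (by simp)
    simp [conjFn, coset, Set.indicator_apply, ← mul_assoc, hmem]
  have key : coset (N : Set G) s (convFn f g) =
      fun x => ∑' u, (g u • conjFn u⁻¹ (coset (N : Set G) (s * u⁻¹) f)) x := by
    ext x
    simp only [Pi.smul_apply, conj]
    by_cases hx : x ∈ N <;> simp [coset, hx, convFn_apply_right]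
  rw [key]
  refine hJc.tsum_mem hJ.2.1 hJ.2.2.1
    (fun u => hJ.2.2.2.1 _ _ (hJinv u⁻¹ ▸ Set.mem_image_of_mem _ (hfJ _))) ?_
  refine Summable.of_nonneg_of_le (fun _ => norm_nonneg _) (fun p => ?_)
    ((Summable.mul_norm hg hf).comp_injective (i := fun p : G × G => (p.1, s * p.2 * p.1⁻¹))
      fun p q h => by
        obtain ⟨h₁, h₂⟩ := Prod.ext_iff.1 h
        simp only at h₁ h₂
        rw [h₁] at h₂
        exact Prod.ext h₁ (mul_left_cancel (mul_right_cancel h₂)))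
  simp only [Pi.smul_apply, conj]
  by_cases hx : p.2 ∈ N <;> simp [hx, mul_nonneg]

theorem subset_bigOplus {T : Set G} (hT : IsTransversal (N : Set G) T)
    (hJ : IsIdealOn (N : Set G) J) : J ⊆ bigOplus (N : Set G) T J := by
  intro f hf
  have hfN := hJ.1 hf
  refine (mem_bigOplus_iff hT hJ).2 ⟨hfN.1, fun s => ?_⟩
  by_cases hs : s ∈ N
  · rw [← one_mul s, coset_mul N 1 hs, coset_one_of_suppIn hfN.2]
    exact (hJ.2.2.2.2 f hf _ (delta_mem_L1On (N.inv_mem hs))).1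
  · have : coset (N : Set G) s f = 0 := by
      ext x
      by_cases hx : x ∈ N
      · simp [coset, hx, hfN.2 (s * x) fun h => hs ((N.mul_mem_cancel_right hx).1 h)]
      · simp [coset, hx]
    rw [this]
    exact hJ.2.1

end Convolution

/-- **Lemma 5.3.** Let `N` be a normal subgroup of `G`, let `T` be a transversal for `N`
in `G`, and let `J` be a non-trivial weak*-closed two-sided ideal of `ℓ¹(N)` satisfying
`δ_s * J * δ_{s⁻¹} = J` for all `s ∈ G`. Then `I = ⊕_{t∈T} δ_t * J` is a non-trivial
weak*-closed two-sided ideal of `ℓ¹(G)`. -/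
theorem bigOplus_isWeakStarClosedIdeal (G : Type*) [Group G] (N : Subgroup G) [N.Normal]
    (T : Set G) (hT : IsTransversal (N : Set G) T) (J : Set (G → ℂ))
    (hJideal : IsIdealOn (N : Set G) J) (hJclosed : WStarClosed J)
    (hJne : J ≠ {0}) (hJproper : J ≠ L1On (N : Set G))
    (hJinv : GConjInvariant J) :
    IsWStarClosedIdeal (bigOplus (N : Set G) T J) ∧
      bigOplus (N : Set G) T J ≠ {0} ∧
      bigOplus (N : Set G) T J ≠ {f : G → ℂ | MemL1 f} := by
  have hmem {f : G → ℂ} := mem_bigOplus_iff hT hJideal (f := f)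
  have hsub := subset_bigOplus hT hJideal
  refine ⟨⟨fun f hf => hf.1, hsub hJideal.2.1, fun f hf g hg => ?_, fun c f hf => ?_,
    fun f hf g hg => ?_, ?_⟩, fun h => ?_, fun h => ?_⟩
  · rw [hmem] at hf hg ⊢
    refine ⟨Summable.of_nonneg_of_le (fun _ => norm_nonneg _) (fun x => norm_add_le _ _)
      (hf.1.add hg.1), fun s => ?_⟩
    rw [coset_add]
    exact hJideal.2.2.1 _ (hf.2 s) _ (hg.2 s)
  · rw [hmem] at hf ⊢
    refine ⟨(hf.1.mul_left ‖c‖).congr fun x => by simp, fun s => ?_⟩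
    rw [coset_smul]
    exact hJideal.2.2.2.1 _ _ (hf.2 s)
  · rw [hmem] at hf
    exact ⟨hmem.2 ⟨hg.convFn hf.1, coset_convFn_mem hJideal hJclosed hf.1 hg hf.2⟩,
      hmem.2 ⟨hf.1.convFn hg, coset_convFn_mem_right hJideal hJclosed hJinv hf.1 hg hf.2⟩⟩
  · have hclosed : IsClosed (⋂ s : G, {f : L1 G | coset (N : Set G) s f.1 ∈ J}) :=
      isClosed_iInter fun s => IsClosed.preimage (continuous_coset (N : Set G) s) hJclosed
    rw [WStarClosed]
    convert hclosed using 1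
    ext f
    simp [hmem, f.2]
  · exact hJne (Set.Subset.antisymm (h ▸ hsub) (Set.singleton_subset_iff.2 hJideal.2.1))
  · refine hJproper (Set.Subset.antisymm hJideal.1 fun f hf => ?_)
    have hfI : f ∈ bigOplus (N : Set G) T J := h ▸ hf.1
    simpa only [coset_one_of_suppIn hf.2] using (hmem.1 hfI).2 1
end
end
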